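/- arXiv:1307.0653 — 9 statements merged into one kernel-verified Lean document; each statement's English description precedes it below -/
import Mathlib

section
/- Assume that X is an abelian group and f : X → ℝ and φ : X × X → ℝ satisfy: (1) f(x+y) − f(x) − f(y) ≥ φ(x, y) for all x, y ∈ X; (2) φ(x, −y) ≥ −φ(x, y) for all x, y ∈ X; (3) limsup_{n→∞} (1/4ⁿ)·φ(2ⁿx, 2ⁿx) < +∞ for all x ∈ X, and liminf_{n→∞} (1/4ⁿ)·φ(2ⁿx, 2ⁿy) ≥ φ(x, y) for all x, y ∈ X; (4) φ(−x, −y) = φ(x, y) for all x, y ∈ X. Then there exists a subadditive function A : X → ℝ such that f(x) = (1/2)·φ(x, x) − A(x) for all x ∈ X. Moreover, φ is biadditive and symmetric. -/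
open Filter Topology in
/-- A superquadratic function whose rescalings along powers of two are eventually bounded
converges, after rescaling, to a quadratic function. -/
theorem exists_tendsto_quadratic {X : Type*} [AddCommGroup X] (e : X → ℝ)
    (he0 : e 0 ≤ 0)
    (hsup : ∀ x y, 2 * e x + 2 * e y ≤ e (x + y) + e (x - y))
    (hbdd : ∀ x, ∃ M : ℝ, ∀ᶠ n : ℕ in atTop, 1 / 4 ^ n * e ((2 ^ n : ℕ) • x) ≤ M) :
    ∃ q : X → ℝ,
      (∀ x, Tendsto (fun n : ℕ => 1 / 4 ^ n * e ((2 ^ n : ℕ) • x)) atTop (𝓝 (q x))) ∧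
      ∀ x y, q (x + y) + q (x - y) = 2 * q x + 2 * q y := by
  have hdouble : ∀ x, 4 * e x ≤ e (x + x) := fun x => by
    have := hsup x x
    rw [sub_self] at this
    linarith
  have hmono : ∀ x, Monotone (fun n : ℕ => 1 / 4 ^ n * e ((2 ^ n : ℕ) • x)) := fun x => by
    refine monotone_nat_of_le_succ fun n => ?_
    have hx : (2 ^ (n + 1) : ℕ) • x = (2 ^ n : ℕ) • x + (2 ^ n : ℕ) • x := by
      rw [← add_nsmul, pow_succ, mul_two]
    rw [hx]
    have h := mul_le_mul_of_nonneg_left (hdouble ((2 ^ n : ℕ) • x))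
      (show (0 : ℝ) ≤ 1 / 4 ^ (n + 1) by positivity)
    refine le_trans (le_of_eq ?_) h
    rw [pow_succ]
    field_simp
  have hlim : ∀ x, ∃ l : ℝ,
      Tendsto (fun n : ℕ => 1 / 4 ^ n * e ((2 ^ n : ℕ) • x)) atTop (𝓝 l) := fun x => by
    obtain ⟨M, hM⟩ := hbdd x
    obtain ⟨N, hN⟩ := eventually_atTop.1 hM
    refine ⟨_, tendsto_atTop_ciSup (hmono x) ⟨M, ?_⟩⟩
    rintro _ ⟨n, rfl⟩
    exact (hmono x (le_max_left n N)).trans (hN _ (le_max_right n N))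
  choose q hq using hlim
  have hqsup : ∀ x y, 2 * q x + 2 * q y ≤ q (x + y) + q (x - y) := fun x y => by
    refine le_of_tendsto_of_tendsto' (((hq x).const_mul 2).add ((hq y).const_mul 2))
      ((hq (x + y)).add (hq (x - y))) fun n => ?_
    have h := mul_le_mul_of_nonneg_left (hsup ((2 ^ n : ℕ) • x) ((2 ^ n : ℕ) • y))
      (show (0 : ℝ) ≤ 1 / 4 ^ n by positivity)
    rw [← nsmul_add, ← nsmul_sub] at h
    linarith
  have hqdouble : ∀ x, q (x + x) = 4 * q x := fun x => by
    refine tendsto_nhds_unique (hq (x + x)) ?_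
    refine (((tendsto_add_atTop_iff_nat 1).2 (hq x)).const_mul 4).congr fun n => ?_
    have hx : (2 ^ (n + 1) : ℕ) • x = (2 ^ n : ℕ) • (x + x) := by
      rw [nsmul_add, ← add_nsmul, pow_succ, mul_two]
    rw [hx, pow_succ]
    field_simp
  refine ⟨q, hq, fun x y => le_antisymm ?_ (hqsup x y)⟩
  have h := hqsup (x + y) (x - y)
  rw [show x + y + (x - y) = x + x by abel, show x + y - (x - y) = y + y by abel,
    hqdouble, hqdouble] at h
  linarith

/-- The polarization of a function satisfying the parallelogram law is additive. -/
theorem polarization_add_left {X : Type*} [AddCommGroup X] (q : X → ℝ)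
    (hq : ∀ x y, q (x + y) + q (x - y) = 2 * q x + 2 * q y) (x y z : X) :
    q (x + y + z) - q (x + y) - q z = (q (x + z) - q x - q z) + (q (y + z) - q y - q z) := by
  have h₁ := hq (x + y) z
  have h₂ := hq (x + z) y
  have h₃ := hq x (y - z)
  have h₄ := hq y z
  rw [show x + z + y = x + y + z by abel] at h₂
  rw [show x + (y - z) = x + y - z by abel, show x - (y - z) = x + z - y by abel] at h₃
  linarith

theorem stmt_3 {X : Type*} [AddCommGroup X] (f : X → ℝ) (φ : X → X → ℝ)
    (h1 : ∀ x y : X, f (x + y) - f x - f y ≥ φ x y)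
    (h2 : ∀ x y : X, φ x (-y) ≥ -φ x y)
    (h3a : ∀ x : X, Filter.limsup
      (fun n : ℕ => ((1 / 4 ^ n * φ ((2 ^ n : ℕ) • x) ((2 ^ n : ℕ) • x) : ℝ) : EReal))
      Filter.atTop < ⊤)
    (h3b : ∀ x y : X, Filter.liminf
      (fun n : ℕ => ((1 / 4 ^ n * φ ((2 ^ n : ℕ) • x) ((2 ^ n : ℕ) • y) : ℝ) : EReal))
      Filter.atTop ≥ ((φ x y : ℝ) : EReal))
    (h4 : ∀ x y : X, φ (-x) (-y) = φ x y) :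
    (∃ A : X → ℝ, (∀ x y : X, A (x + y) ≤ A x + A y) ∧
      ∀ x : X, f x = (1 / 2) * φ x x - A x) ∧
    (∀ x y z : X, φ (x + y) z = φ x z + φ y z) ∧
    (∀ x y z : X, φ x (y + z) = φ x y + φ x z) ∧
    (∀ x y : X, φ x y = φ y x) := by
  have hφ0 : 0 ≤ φ 0 0 := by
    have := h2 0 0
    rw [neg_zero] at this
    linarith
  have hf0 : f 0 ≤ 0 := by
    have := h1 0 0
    rw [add_zero] at this
    linarith
  set e : X → ℝ := fun x => (f x + f (-x)) / 2 with he
  have heven : ∀ x, e (-x) = e x := fun x => by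
    simp only [he, neg_neg]
    ring
  have he0 : e 0 ≤ 0 := by
    simp only [he, neg_zero]
    linarith
  have heφ : ∀ x y, φ x y ≤ e (x + y) - e x - e y := fun x y => by
    have h := h1 x y
    have h' := h1 (-x) (-y)
    rw [h4, ← neg_add] at h'
    simp only [he]
    linarith
  have heφ' : ∀ x y, -φ x y ≤ e (x - y) - e x - e y := fun x y => by
    have h := heφ x (-y)
    rw [← sub_eq_add_neg, heven] at h
    linarith [h2 x y]
  have hbdd : ∀ x, ∃ M : ℝ, ∀ᶠ n : ℕ in Filter.atTop,
      1 / 4 ^ n * e ((2 ^ n : ℕ) • x) ≤ M := fun x => by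
    obtain ⟨M, hM, -⟩ := EReal.lt_iff_exists_real_btwn.1 (h3a x)
    refine ⟨M / 2, (Filter.eventually_lt_of_limsup_lt hM).mono fun n hn => ?_⟩
    have hn' := EReal.coe_lt_coe_iff.1 hn
    have h := heφ' ((2 ^ n : ℕ) • x) ((2 ^ n : ℕ) • x)
    rw [sub_self] at h
    have h' := mul_le_mul_of_nonneg_left
      (show 2 * e ((2 ^ n : ℕ) • x) ≤ φ ((2 ^ n : ℕ) • x) ((2 ^ n : ℕ) • x) by linarith)
      (show (0 : ℝ) ≤ 1 / 4 ^ n by positivity)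
    linarith
  obtain ⟨q, hq, hpar⟩ := exists_tendsto_quadratic e he0
    (fun x y => by linarith [heφ x y, heφ' x y]) hbdd
  have hqeven : ∀ x, q (-x) = q x := fun x =>
    tendsto_nhds_unique (hq (-x)) ((hq x).congr fun n => by rw [smul_neg, heven])
  have hφq : ∀ x y, φ x y ≤ q (x + y) - q x - q y := fun x y => by
    rw [← EReal.coe_le_coe_iff]
    have hlim := (continuous_coe_real_ereal.tendsto _).comp
      (((hq (x + y)).sub (hq x)).sub (hq y))
    rw [← hlim.liminf_eq]
    refine (h3b x y).trans (Filter.liminf_le_liminf (Filter.Eventually.of_forall fun n => ?_))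
    refine EReal.coe_le_coe_iff.2 ?_
    have h := mul_le_mul_of_nonneg_left (heφ ((2 ^ n : ℕ) • x) ((2 ^ n : ℕ) • y))
      (show (0 : ℝ) ≤ 1 / 4 ^ n by positivity)
    rw [← nsmul_add] at h
    linarith
  have hφ : ∀ x y, φ x y = q (x + y) - q x - q y := fun x y => by
    refine le_antisymm (hφq x y) ?_
    have h := hφq x (-y)
    rw [← sub_eq_add_neg, hqeven] at h
    linarith [h2 x y, hpar x y]
  have hadd : ∀ x y z, φ (x + y) z = φ x z + φ y z := fun x y z => by
    simp only [hφ]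
    exact polarization_add_left q hpar x y z
  have hsymm : ∀ x y, φ x y = φ y x := fun x y => by
    rw [hφ, hφ, add_comm y x]
    ring
  have hadd' : ∀ x y z, φ x (y + z) = φ x y + φ x z := fun x y z => by
    rw [hsymm, hadd, hsymm y, hsymm z]
  refine ⟨⟨fun x => 1 / 2 * φ x x - f x, fun x y => ?_, fun x => by ring⟩, hadd, hadd', hsymm⟩
  beta_reduce
  rw [hadd, hadd', hadd', hsymm y x]
  linarith [h1 x y]
end

section
/- Assume that X is a uniquely 2-divisible abelian group and f : X → ℝ, φ : X × X → ℝ satisfy: (1) f(x+y) − f(x) − f(y) ≥ φ(x, y) for all x, y ∈ X; (2) φ(x, −y) ≥ −φ(x, y) for all x, y ∈ X; (3) φ(2x, 2x) ≤ 4·φ(x, x) for all x ∈ X; (4) for every x ∈ X there exists k₀ ∈ ℕ such that for all k ≥ k₀ one has f(x/2ᵏ) + f(−x/2ᵏ) ≥ 0. Then there exists an additive function a : X → ℝ such that f(x) = (1/2)·φ(x, x) + a(x) for all x ∈ X. Moreover, φ is biadditive and symmetric. -/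
/-- In a 2-divisible abelian group every element is divisible by every power of 2. -/
theorem exists_two_pow_nsmul_eq {X : Type*} [AddCommGroup X]
    (hdiv : Function.Surjective (fun x : X => x + x)) (k : ℕ) (x : X) :
    ∃ y : X, (2 ^ k : ℕ) • y = x := by
  induction k generalizing x with
  | zero => exact ⟨x, by simp⟩
  | succ k ih =>
    obtain ⟨z, rfl⟩ := hdiv x
    obtain ⟨y, rfl⟩ := ih z
    exact ⟨y, by simp only [pow_succ, mul_nsmul, two_nsmul]⟩

/-- The polarization of a function satisfying the parallelogram law is additive. -/
theorem polar_add_of_parallelogram {X : Type*} [AddCommGroup X] {q : X → ℝ}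
    (hq : ∀ x y, q (x + y) + q (x - y) = 2 * q x + 2 * q y) (x y z : X) :
    q (x + y + z) - q (x + y) - q z = q (x + z) - q x - q z + (q (y + z) - q y - q z) := by
  have e1 := hq (x + z) y
  have e2 := hq x (z - y)
  have e3 := hq (x + y) z
  have e4 := hq z y
  rw [show x + z + y = x + y + z by abel] at e1
  rw [show x + (z - y) = x + z - y by abel, show x - (z - y) = x + y - z by abel] at e2
  rw [add_comm z y] at e4
  linarith

theorem stmt_4 {X : Type*} [AddCommGroup X]
    (hdiv : Function.Bijective (fun x : X => x + x))
    (f : X → ℝ) (φ : X → X → ℝ)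
    (h1 : ∀ x y : X, f (x + y) - f x - f y ≥ φ x y)
    (h2 : ∀ x y : X, φ x (-y) ≥ -φ x y)
    (h3 : ∀ x : X, φ (x + x) (x + x) ≤ 4 * φ x x)
    (h4 : ∀ x : X, ∃ k₀ : ℕ, ∀ k ≥ k₀, ∀ y : X, (2 ^ k : ℕ) • y = x → f y + f (-y) ≥ 0) :
    (∃ a : X → ℝ, (∀ x y : X, a (x + y) = a x + a y) ∧
      ∀ x : X, f x = (1 / 2) * φ x x + a x) ∧
    (∀ x y z : X, φ (x + y) z = φ x z + φ y z) ∧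
    (∀ x y z : X, φ x (y + z) = φ x y + φ x z) ∧
    (∀ x y : X, φ x y = φ y x) := by
  have hf0 : f 0 = 0 := by
    obtain ⟨k, hk⟩ := h4 0
    have e1 := hk k le_rfl 0 (by simp)
    have e2 := h1 0 0
    have e3 := h2 0 0
    simp only [neg_zero, add_zero] at e1 e2 e3
    linarith
  have hle (x : X) : f x + f (-x) ≤ φ x x := by
    have e1 := h1 x (-x)
    have e2 := h2 x x
    rw [add_neg_cancel, hf0] at e1
    linarith
  have hle' (x : X) : f x + f (-x) ≤ φ (-x) (-x) := by
    have e := hle (-x)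
    rw [neg_neg] at e
    linarith
  have hdbl (x : X) : 2 * (f x + f (-x)) + (φ x x + φ (-x) (-x)) ≤ f (x + x) + f (-(x + x)) := by
    have e1 := h1 x x
    have e2 := h1 (-x) (-x)
    rw [neg_add]
    linarith
  have hnonneg (x : X) : 0 ≤ f x + f (-x) := by
    obtain ⟨k, hk⟩ := h4 x
    obtain ⟨y, hy⟩ := exists_two_pow_nsmul_eq hdiv.2 k x
    have hg := hk k le_rfl y hy
    have key (n : ℕ) : 0 ≤ f ((2 ^ n : ℕ) • y) + f (-((2 ^ n : ℕ) • y)) := by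
      induction n with
      | zero => simpa using hg
      | succ n ih =>
        rw [pow_succ, mul_nsmul', two_nsmul, nsmul_add]
        linarith [hdbl ((2 ^ n : ℕ) • y), hle ((2 ^ n : ℕ) • y), hle' ((2 ^ n : ℕ) • y)]
    simpa only [hy] using key k
  have hbound (n : ℕ) (x : X) :
      n * (φ x x + φ (-x) (-x) - 2 * (f x + f (-x))) ≤ 2 * (f x + f (-x)) := by
    induction n generalizing x with
    | zero => simpa using hnonneg x
    | succ n ih =>
      obtain ⟨y, rfl⟩ := hdiv.2 x
      have e1 := ih y
      have e2 := hdbl y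
      have e3 := h3 y
      have e4 := h3 (-y)
      have e5 := hnonneg y
      simp only [← neg_add] at e4
      set D := φ y y + φ (-y) (-y) - 2 * (f y + f (-y)) with hD
      have e6 : φ (y + y) (y + y) + φ (-(y + y)) (-(y + y)) -
          2 * (f (y + y) + f (-(y + y))) ≤ 2 * D := by linarith
      have e7 := mul_le_mul_of_nonneg_left e6 (Nat.cast_nonneg (α := ℝ) (n + 1))
      push_cast at e7 ⊢
      linarith
  have hsum (x : X) : φ x x + φ (-x) (-x) - 2 * (f x + f (-x)) ≤ 0 := by
    by_contra! hpos
    obtain ⟨n, hn⟩ := exists_nat_gt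
      (2 * (f x + f (-x)) / (φ x x + φ (-x) (-x) - 2 * (f x + f (-x))))
    rw [div_lt_iff₀ hpos] at hn
    linarith [hbound n x]
  have hdiag (x : X) : φ x x = f x + f (-x) := by
    linarith [hsum x, hle x, hle' x]
  have hdiag_neg (x : X) : φ (-x) (-x) = φ x x := by
    linarith [hsum x, hle x, hle' x]
  have hdiag_dbl (x : X) : φ (x + x) (x + x) = 4 * φ x x := by
    linarith [h3 x, hdbl x, hdiag x, hdiag (x + x), hdiag_neg x]
  have hpair (x y : X) : φ x y + φ (-x) (-y) ≤ φ (x + y) (x + y) - φ x x - φ y y := by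
    have e1 := h1 x y
    have e2 := h1 (-x) (-y)
    rw [← neg_add] at e2
    linarith [hdiag (x + y), hdiag x, hdiag y]
  have hpair_neg (x y : X) :
      φ x (-y) + φ (-x) y ≤ φ (x - y) (x - y) - φ x x - φ y y := by
    have e := hpair x (-y)
    rwa [neg_neg, ← sub_eq_add_neg, hdiag_neg y] at e
  have hsuper (x y : X) :
      2 * φ x x + 2 * φ y y ≤ φ (x + y) (x + y) + φ (x - y) (x - y) := by
    have e := h2 (-x) y
    linarith [h2 x y, hpair x y, hpair_neg x y]
  have hpar (x y : X) :
      φ (x + y) (x + y) + φ (x - y) (x - y) = 2 * φ x x + 2 * φ y y := by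
    have e := hsuper (x + y) (x - y)
    rw [show x + y + (x - y) = x + x by abel, show x + y - (x - y) = y + y by abel,
      hdiag_dbl, hdiag_dbl] at e
    linarith [hsuper x y]
  have hodd (x y : X) : φ x (-y) = -φ x y := by
    linarith [h2 x y, h2 (-x) y, hpair x y, hpair_neg x y, hpar x y]
  have hcauchy (x y : X) : φ x y = f (x + y) - f x - f y := by
    have e1 := h1 x y
    have e2 := h1 (-x) (-y)
    rw [← neg_add] at e2
    linarith [hdiag (x + y), hdiag x, hdiag y, hpair x y, hpair_neg x y, hpar x y,
      h2 x y, h2 (-x) y]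
  have hsymm (x y : X) : φ x y = φ y x := by
    rw [hcauchy, hcauchy, add_comm]
    ring
  have hpolar (x y : X) : 2 * φ x y = φ (x + y) (x + y) - φ x x - φ y y := by
    have e1 := hodd (-x) y
    have e2 := hsymm (-x) y
    have e3 := hodd y x
    have e4 := hsymm x y
    linarith [hpair x y, hpair_neg x y, hpar x y, hodd x y]
  have hadd (x y z : X) : φ (x + y) z = φ x z + φ y z := by
    have e := polar_add_of_parallelogram (q := fun x => φ x x) hpar x y z
    linarith [hpolar (x + y) z, hpolar x z, hpolar y z]
  refine ⟨⟨fun x => f x - 1 / 2 * φ x x, fun x y => ?_, fun x => by ring⟩, hadd,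
    fun x y z => ?_, hsymm⟩
  · linarith [hpolar x y, hcauchy x y]
  · rw [hsymm, hadd, hsymm y, hsymm z]
end

section
/- Let X be an integral domain in which 2 and 3 are invertible. Functions f, g : X → X fulfill the functional equation g(x+y) − g(x) − g(y) = x·f(y) + y·f(x) for all x, y ∈ X if and only if there exist two additive mappings A₁, A₂ : X → X and a constant c ∈ X such that for all x ∈ X: f(x) = A₁(x) + c·x² and g(x) = A₂(x) + x·A₁(x) + (1/3)·c·x³ (i.e., 3·g(x) = 3·A₂(x) + 3·x·A₁(x) + c·x³). -/
/-- A function `f` for which `x * f y + y * f x` is a Cauchy difference has itself the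
Cauchy difference `(x, y) ↦ x * y * k`, where `k = f 2 - 2 * f 1`. -/
theorem cauchyDifference_eq_mul {X : Type*} [CommRing X] {f g : X → X}
    (h : ∀ x y : X, g (x + y) - g x - g y = x * f y + y * f x) (x y : X) :
    f (x + y) - f x - f y = x * y * (f (1 + 1) - f 1 - f 1) := by
  have cocycle (x y z : X) :
      z * (f (x + y) - f x - f y) = x * (f (y + z) - f y - f z) := by
    have assoc := h (x + y) z
    rw [add_assoc] at assoc
    linear_combination h x (y + z) + h y z - assoc - h x y
  linear_combination cocycle x y 1 + x * cocycle y 1 1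

theorem stmt_6 {X : Type*} [CommRing X] [IsDomain X]
    (h2 : IsUnit (2 : X)) (h3 : IsUnit (3 : X)) (f g : X → X) :
    (∀ x y : X, g (x + y) - g x - g y = x * f y + y * f x) ↔
    (∃ A₁ A₂ : X → X, ∃ c : X,
      (∀ x y : X, A₁ (x + y) = A₁ x + A₁ y) ∧
      (∀ x y : X, A₂ (x + y) = A₂ x + A₂ y) ∧
      (∀ x : X, f x = A₁ x + c * x ^ 2) ∧
      (∀ x : X, 3 * g x = 3 * A₂ x + 3 * x * A₁ x + c * x ^ 3)) := by
  constructor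
  · intro h
    obtain ⟨u, hu⟩ := h2.exists_right_inv
    obtain ⟨v, hv⟩ := h3.exists_right_inv
    obtain ⟨k, hf⟩ : ∃ k, ∀ x y, f (x + y) - f x - f y = x * y * k :=
      ⟨_, cauchyDifference_eq_mul h⟩
    refine ⟨fun x => f x - u * k * x ^ 2,
      fun x => g x - x * (f x - u * k * x ^ 2) - v * (u * k) * x ^ 3, u * k, ?_, ?_, ?_, ?_⟩
    · intro x y
      linear_combination hf x y - x * y * k * hu
    · intro x y
      linear_combination h x y - (x + y) * (hf x y - x * y * k * hu)
        - u * k * x * y * (x + y) * hv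
    · intro x
      ring
    · intro x
      linear_combination u * k * x ^ 3 * hv
  · rintro ⟨A₁, A₂, c, hA₁, hA₂, hf, hg⟩ x y
    apply h3.mul_left_cancel
    rw [hf x, hf y]
    linear_combination hg (x + y) - hg x - hg y + 3 * hA₂ x y + 3 * (x + y) * hA₁ x y
end

section
/- Let X be an integral domain in which 2 and 3 are invertible, and let f, g : X → X satisfy g(x+y) − g(x) − g(y) = x·f(y) + y·f(x) for all x, y ∈ X. Then the following statements are equivalent: (i) f = 0 and g is additive; (ii) f is even (f(−x) = f(x) for all x) and f(1) = 0; (iii) g is odd (g(−x) = −g(x) for all x) and g(2) = 2·g(1). -/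
/-- If `x * f y + y * f x` is a Cauchy difference, that of `f` is a multiple of `x * y`. -/
theorem cauchy_difference_eq_mul {X : Type*} [CommRing X] {f g : X → X}
    (h : ∀ x y : X, g (x + y) - g x - g y = x * f y + y * f x) (x y : X) :
    f (x + y) - f x - f y = (f (1 + 1) - f 1 - f 1) * (x * y) := by
  have cocycle (x y z : X) :
      z * (f (x + y) - f x - f y) = x * (f (y + z) - f y - f z) := by
    have e := h x (y + z)
    rw [← add_assoc] at e
    linear_combination e + h y z - h (x + y) z - h x y
  have e := cocycle y 1 1
  linear_combination cocycle x y 1 + x * e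

theorem eq_zero_of_even_of_map_one {X : Type*} [CommRing X]
    (h2 : IsUnit (2 : X)) {f g : X → X}
    (h : ∀ x y : X, g (x + y) - g x - g y = x * f y + y * f x)
    (even : ∀ x : X, f (-x) = f x) (h1 : f 1 = 0) (x : X) : f x = 0 := by
  have D := cauchy_difference_eq_mul h
  have h0 : f 0 = 0 := by
    have e := D 0 0
    rw [add_zero] at e
    linear_combination -e
  have sq (x : X) : 2 * f x = (f (1 + 1) - f 1 - f 1) * (x * x) := by
    have e := D x (-x)
    rw [add_neg_cancel, even, h0] at e
    linear_combination -e
  apply h2.mul_left_cancel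
  linear_combination sq x - x * x * sq 1 + 2 * x * x * h1

theorem stmt_7 {X : Type*} [CommRing X] [IsDomain X]
    (h2 : IsUnit (2 : X)) (h3 : IsUnit (3 : X)) (f g : X → X)
    (h : ∀ x y : X, g (x + y) - g x - g y = x * f y + y * f x) :
    (((∀ x : X, f x = 0) ∧ (∀ x y : X, g (x + y) = g x + g y)) ↔
      ((∀ x : X, f (-x) = f x) ∧ f 1 = 0)) ∧
    (((∀ x : X, f (-x) = f x) ∧ f 1 = 0) ↔
      ((∀ x : X, g (-x) = -g x) ∧ g 2 = 2 * g 1)) := by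
  have g0 : g 0 = 0 := by
    have e := h 0 0
    rw [add_zero] at e
    linear_combination -e
  have neg (x : X) : g x + g (-x) = x * (f x - f (-x)) := by
    have e := h x (-x)
    rw [add_neg_cancel, g0] at e
    linear_combination -e
  have two : g 2 - 2 * g 1 = 2 * f 1 := by
    have e := h 1 1
    rw [one_add_one_eq_two] at e
    linear_combination e
  refine ⟨⟨fun ⟨hf, _⟩ => ⟨fun x => by rw [hf, hf], hf 1⟩, fun ⟨even, h1⟩ => ?_⟩,
    fun ⟨even, h1⟩ => ⟨fun x => ?_, ?_⟩, fun ⟨odd, hg⟩ => ⟨fun x => ?_, ?_⟩⟩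
  · have hf := eq_zero_of_even_of_map_one h2 h even h1
    exact ⟨hf, fun x y => by linear_combination h x y + x * hf y + y * hf x⟩
  · linear_combination neg x - x * even x
  · linear_combination two + 2 * h1
  · obtain rfl | hx := eq_or_ne x 0
    · rw [neg_zero]
    · apply mul_left_cancel₀ hx
      linear_combination neg x - odd x
  · apply h2.mul_left_cancel
    linear_combination hg - two
end

section
/- Let X be an integral domain in which 2 and 3 are invertible. A function f : X → X fulfills f(x+y) − f(x) − f(y) = x·f(y) + y·f(x) for all x, y ∈ X if and only if f is identically zero. -/
theorem stmt_8 {X : Type*} [CommRing X] [IsDomain X]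
    (h2 : IsUnit (2 : X)) (h3 : IsUnit (3 : X)) (f : X → X) :
    (∀ x y : X, f (x + y) - f x - f y = x * f y + y * f x) ↔
    (∀ x : X, f x = 0) := by
  refine ⟨fun h => ?_, fun h x y => by simp [h]⟩
  -- Expanding `f (x + 1 + 1)` in two ways shows that `f` is linear.
  have linear : ∀ x, f x = x * f 1 := by
    intro x
    have e₁ := h x (1 + 1)
    rw [← add_assoc] at e₁
    linear_combination e₁ - h (x + 1) 1 - 2 * h x 1 + (1 + x) * h 1 1
  have two_mul_f_one : 2 * f 1 = 0 := by
    linear_combination linear (1 + 1) - h 1 1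
  have f_one : f 1 = 0 := h2.mul_right_eq_zero.mp two_mul_f_one
  intro x
  rw [linear x, f_one, mul_zero]
end

section
/- Assume that functions f, g : ℝ → ℝ fulfill the inequality g(x+y) − g(x) − g(y) ≥ x·f(y) + y·f(x) for all x, y ∈ ℝ. If f is odd (f(−x) = −f(x) for all x ∈ ℝ) and f(2x) = 2·f(x) for all x ∈ ℝ, then f is additive and there exists a subadditive mapping A : ℝ → ℝ such that g(x) = x·f(x) − A(x) for all x ∈ ℝ. -/
/-- An odd function whose Cauchy difference at `(x, y)` has the same sign as `x + y`
is additive. -/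
theorem additive_of_odd_of_mul_cauchyDifference_nonneg {f : ℝ → ℝ}
    (hodd : ∀ x : ℝ, f (-x) = -f x)
    (hf : ∀ x y : ℝ, 0 ≤ (x + y) * (f (x + y) - f x - f y)) (x y : ℝ) :
    f (x + y) = f x + f y := by
  have lower : ∀ x y : ℝ, 0 < x + y → f x + f y ≤ f (x + y) := fun x y hs => by
    linarith [nonneg_of_mul_nonneg_right (hf x y) hs]
  have upper : ∀ x y : ℝ, 0 < x → f (x + y) ≤ f x + f y := fun x y hx => by
    have := lower (x + y) (-y) (by linarith)
    rw [hodd, add_neg_cancel_right] at this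
    linarith
  have pos : ∀ x y : ℝ, 0 < x + y → f (x + y) = f x + f y := fun x y hs => by
    refine le_antisymm ?_ (lower x y hs)
    rcases lt_or_ge 0 x with hx | hx
    · exact upper x y hx
    · rw [add_comm x y, add_comm (f x)]
      exact upper y x (by linarith)
  rcases lt_trichotomy (x + y) 0 with hs | hs | hs
  · have := pos (-x) (-y) (by linarith)
    rw [← neg_add, hodd, hodd, hodd] at this
    linarith
  · have h0 : f 0 = 0 := by
      have := hodd 0
      rw [neg_zero] at this
      linarith
    rw [hs, h0, eq_neg_of_add_eq_zero_right hs, hodd, add_neg_cancel]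
  · exact pos x y hs

theorem apply_two_pow_mul {f : ℝ → ℝ} (h2 : ∀ x : ℝ, f (2 * x) = 2 * f x) (n : ℕ) (x : ℝ) :
    f (2 ^ n * x) = 2 ^ n * f x := by
  induction n with
  | zero => simp
  | succ n ih => rw [pow_succ', mul_assoc, h2, ih, mul_assoc]

theorem apply_two_pow_mul_le {A : ℝ → ℝ} (h2 : ∀ x : ℝ, A (2 * x) ≤ 2 * A x) (n : ℕ) (x : ℝ) :
    A (2 ^ n * x) ≤ 2 ^ n * A x := by
  induction n with
  | zero => simp
  | succ n ih =>
    rw [pow_succ', mul_assoc, mul_assoc]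
    linarith [h2 (2 ^ n * x)]

theorem nonneg_of_forall_neg_le_two_pow_mul {t C : ℝ} (h : ∀ n : ℕ, -C ≤ 2 ^ n * t) : 0 ≤ t := by
  by_contra! ht
  obtain ⟨n, hn⟩ := pow_unbounded_of_one_lt (C / -t) (one_lt_two (α := ℝ))
  rw [div_lt_iff₀ (by linarith)] at hn
  linarith [h n]

theorem stmt_9 (f g : ℝ → ℝ)
    (h : ∀ x y : ℝ, g (x + y) - g x - g y ≥ x * f y + y * f x)
    (hodd : ∀ x : ℝ, f (-x) = -f x)
    (h2 : ∀ x : ℝ, f (2 * x) = 2 * f x) :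
    (∀ x y : ℝ, f (x + y) = f x + f y) ∧
    (∃ A : ℝ → ℝ, (∀ x y : ℝ, A (x + y) ≤ A x + A y) ∧
      ∀ x : ℝ, g x = x * f x - A x) := by
  obtain ⟨A, hA⟩ : ∃ A : ℝ → ℝ, ∀ x, g x = x * f x - A x :=
    ⟨fun x => x * f x - g x, fun x => by ring⟩
  have key : ∀ x y, A (x + y) - A x - A y ≤ (x + y) * (f (x + y) - f x - f y) := fun x y => by
    have := h x y
    rw [hA, hA x, hA y] at this
    linarith
  have hA2 : ∀ x, A (2 * x) ≤ 2 * A x := fun x => by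
    have := key x x
    rw [← two_mul, h2] at this
    linarith
  have hAneg : ∀ x, 0 ≤ A x + A (-x) := fun x => by
    have h0 := hA2 0
    have := key x (-x)
    rw [add_neg_cancel] at this
    rw [mul_zero] at h0
    linarith
  have hf : ∀ x y, f (x + y) = f x + f y := by
    refine additive_of_odd_of_mul_cauchyDifference_nonneg hodd fun x y => ?_
    refine nonneg_of_forall_neg_le_two_pow_mul (C := A (-(x + y)) + A x + A y) fun n => ?_
    have hk := key (2 ^ n * x) (2 ^ n * y)
    rw [← mul_add, apply_two_pow_mul h2, apply_two_pow_mul h2, apply_two_pow_mul h2] at hk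
    have hneg := hAneg (2 ^ n * (x + y))
    rw [← mul_neg] at hneg
    refine le_of_mul_le_mul_left ?_ (pow_pos (two_pos (α := ℝ)) n)
    linarith [apply_two_pow_mul_le hA2 n x, apply_two_pow_mul_le hA2 n y,
      apply_two_pow_mul_le hA2 n (-(x + y))]
  refine ⟨hf, A, fun x y => ?_, hA⟩
  have := key x y
  rw [hf] at this
  linarith
end

section
/- Assume that functions f, g : ℝ → ℝ fulfill the inequality g(x+y) − g(x) − g(y) ≥ x·f(y) + y·f(x) for all x, y ∈ ℝ, that f is odd (f(−x) = −f(x) for all x ∈ ℝ) and f(2x) = 2·f(x) for all x ∈ ℝ. If additionally for each x ∈ ℝ there exists k₀ ∈ ℕ such that for every k ≥ k₀ one has g(x/2ᵏ) + g(−x/2ᵏ) ≥ 0, then the function A : ℝ → ℝ defined by A(x) = x·f(x) − g(x) is additive (so g(x) = x·f(x) − A(x) with A additive). -/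
lemma nonpos_of_eventually_le_div_two_pow {a b : ℝ}
    (hab : ∀ᶠ k : ℕ in Filter.atTop, a ≤ b / 2 ^ k) : a ≤ 0 := by
  have hlim : Filter.Tendsto (fun k : ℕ => b / (2 : ℝ) ^ k) Filter.atTop (nhds 0) :=
    tendsto_const_nhds.div_atTop (tendsto_pow_atTop_atTop_of_one_lt one_lt_two)
  exact ge_of_tendsto hlim hab

lemma map_div_two_pow {F : ℝ → ℝ} (hF : ∀ x, F (2 * x) = 2 * F x) (x : ℝ) (k : ℕ) :
    F (x / 2 ^ k) = F x / 2 ^ k := by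
  induction k with
  | zero => simp
  | succ k ih =>
    have hk := hF (x / 2 ^ (k + 1))
    rw [show 2 * (x / 2 ^ (k + 1)) = x / 2 ^ k by field_simp; ring, ih] at hk
    rw [pow_succ (2 : ℝ) k, ← div_div (F x), hk, ← pow_succ, mul_div_cancel_left₀ _ two_ne_zero]

lemma le_two_pow_mul_map_div {F : ℝ → ℝ} (hF : ∀ x, F (2 * x) ≤ 2 * F x) (x : ℝ) (k : ℕ) :
    F x ≤ 2 ^ k * F (x / 2 ^ k) := by
  induction k with
  | zero => simp
  | succ k ih =>
    have hk := hF (x / 2 ^ (k + 1))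
    rw [show 2 * (x / 2 ^ (k + 1)) = x / 2 ^ k by field_simp; ring] at hk
    calc F x ≤ 2 ^ k * F (x / 2 ^ k) := ih
      _ ≤ 2 ^ k * (2 * F (x / 2 ^ (k + 1))) := by gcongr
      _ = 2 ^ (k + 1) * F (x / 2 ^ (k + 1)) := by ring

theorem stmt_10 (f g : ℝ → ℝ)
    (h : ∀ x y : ℝ, g (x + y) - g x - g y ≥ x * f y + y * f x)
    (hodd : ∀ x : ℝ, f (-x) = -f x)
    (h2 : ∀ x : ℝ, f (2 * x) = 2 * f x)
    (hg : ∀ x : ℝ, ∃ k₀ : ℕ, ∀ k ≥ k₀, g (x / 2 ^ k) + g (-(x / 2 ^ k)) ≥ 0) :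
    ∀ x y : ℝ, (x + y) * f (x + y) - g (x + y) = (x * f x - g x) + (y * f y - g y) := by
  obtain ⟨A, hA⟩ : ∃ A : ℝ → ℝ, ∀ x, A x = x * f x - g x := ⟨_, fun _ => rfl⟩
  have hA2 (x : ℝ) : A (2 * x) ≤ 2 * A x := by
    have hx := h x x
    rw [← two_mul] at hx
    rw [hA, hA, h2]
    linarith
  have hA_add_neg_nonneg (x : ℝ) : 0 ≤ A x + A (-x) := by
    have hx := h x (-x)
    have h0 := h 0 0
    simp only [add_neg_cancel, add_zero, zero_mul, hodd] at hx h0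
    rw [hA, hA, hodd]
    linarith
  have hA_add_neg_nonpos (x : ℝ) : A x + A (-x) ≤ 0 := by
    apply nonpos_of_eventually_le_div_two_pow (b := 2 * x * f x)
    obtain ⟨k₀, hk₀⟩ := hg x
    filter_upwards [Filter.eventually_ge_atTop k₀] with k hk
    have hgk := hk₀ k hk
    have hE : ∀ x, A (2 * x) + A (-(2 * x)) ≤ 2 * (A x + A (-x)) := fun x => by
      have h₁ := hA2 x
      have h₂ := hA2 (-x)
      rw [mul_neg] at h₂
      linarith
    calc A x + A (-x) ≤ 2 ^ k * (A (x / 2 ^ k) + A (-(x / 2 ^ k))) :=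
          le_two_pow_mul_map_div (F := fun x => A x + A (-x)) hE x k
      _ ≤ 2 ^ k * (2 * (x / 2 ^ k) * (f x / 2 ^ k)) := by
          gcongr
          rw [hA, hA, hodd, map_div_two_pow h2]
          linarith
      _ = 2 * x * f x / 2 ^ k := by field_simp
  have hAodd (x : ℝ) : A (-x) = -A x := by
    linarith [hA_add_neg_nonneg x, hA_add_neg_nonpos x]
  have hA2_eq (x : ℝ) : A (2 * x) = 2 * A x := by
    have hx := hA2 (-x)
    rw [mul_neg, hAodd, hAodd] at hx
    linarith [hA2 x]
  have hdefect (x y : ℝ) :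
      A (x + y) - A x - A y ≤ (x + y) * (f (x + y) - f x - f y) := by
    rw [hA, hA, hA]
    linarith [h x y]
  have hsub (x y : ℝ) : A (x + y) - A x - A y ≤ 0 := by
    apply nonpos_of_eventually_le_div_two_pow (b := (x + y) * (f (x + y) - f x - f y))
    refine Filter.Eventually.of_forall fun k => ?_
    have hk := hdefect (x / 2 ^ k) (y / 2 ^ k)
    simp only [← add_div, map_div_two_pow h2, map_div_two_pow hA2_eq, ← sub_div] at hk
    rw [← mul_div_assoc, div_mul_eq_mul_div] at hk
    exact (div_le_div_iff_of_pos_right (pow_pos two_pos k)).mp hk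
  intro x y
  rw [← hA, ← hA, ← hA]
  have hneg := hsub (-x) (-y)
  rw [← neg_add, hAodd, hAodd, hAodd] at hneg
  linarith [hsub x y]
end

section
/- Let X be an integral domain and let f, g : X → X satisfy g(x+y) − g(x) − g(y) = x·f(y) + y·f(x) for all x, y ∈ X. Then the odd part of f, i.e., the function f_o : X → X defined by f_o(x) = f(x) − f(−x), is additive: f_o(x+y) = f_o(x) + f_o(y) for all x, y ∈ X. -/
theorem stmt_16 {X : Type*} [CommRing X] [IsDomain X] (f g : X → X)
    (h : ∀ x y : X, g (x + y) - g x - g y = x * f y + y * f x) :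
    ∀ x y : X, (f (x + y) - f (-(x + y))) = (f x - f (-x)) + (f y - f (-y)) := by
  have cocycle (x y z : X) :
      z * (f (x + y) - f x - f y) = x * (f (y + z) - f y - f z) := by
    have hxyz := h x (y + z)
    rw [← add_assoc] at hxyz
    linear_combination hxyz + h y z - h (x + y) z - h x y
  have bilinear (x y : X) : f (x + y) - f x - f y = x * y * (f (1 + 1) - f 1 - f 1) := by
    linear_combination cocycle x y 1 + x * cocycle y 1 1
  intro x y
  have hneg := bilinear (-x) (-y)
  rw [← neg_add] at hneg
  linear_combination bilinear x y - hneg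
end

section
/- Let X be an integral domain and let f, g : X → X satisfy g(x+y) − g(x) − g(y) = x·f(y) + y·f(x) for all x, y ∈ X. Define g_o : X → X by g_o(x) = g(x) − g(−x) and let c = f(1) + f(−1). Then 2·(g_o(x+y) − g_o(x) − g_o(y)) = 2·c·x·y·(x+y) for all x, y ∈ X. -/
/-- The Cauchy difference of `f` is the bilinear form `f 1 + f (-1)` times `x * y`. -/
theorem cauchy_difference_eq {X : Type*} [CommRing X] (f g : X → X)
    (h : ∀ x y : X, g (x + y) - g x - g y = x * f y + y * f x) (x y : X) :
    f (x + y) - f x - f y = (f 1 + f (-1)) * x * y := by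
  have cocycle (x y z : X) :
      z * (f (x + y) - f x - f y) = x * (f (y + z) - f y - f z) := by
    have h₁ := h (x + y) z
    rw [add_assoc x y z] at h₁
    linear_combination h x (y + z) + h y z - h x y - h₁
  have bilin (x y : X) : f (x + y) - f x - f y = x * y * (f (1 + 1) - f 1 - f 1) := by
    have h₁ := cocycle y 1 1
    rw [add_comm y 1] at h₁
    have h₂ := cocycle x y 1
    rw [add_comm y 1] at h₂
    linear_combination h₂ + x * h₁
  have h₀ := bilin 0 0
  have h₁ := bilin 1 (-1)
  rw [add_zero] at h₀
  rw [add_neg_cancel] at h₁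
  linear_combination bilin x y + x * y * (h₁ + h₀)

theorem stmt_18 {X : Type*} [CommRing X] [IsDomain X] (f g : X → X)
    (h : ∀ x y : X, g (x + y) - g x - g y = x * f y + y * f x) :
    ∀ x y : X,
      2 * ((g (x + y) - g (-(x + y))) - (g x - g (-x)) - (g y - g (-y))) =
        2 * (f 1 + f (-1)) * x * y * (x + y) := by
  intro x y
  have f_zero : f 0 = 0 := by
    have h₀ := cauchy_difference_eq f g h 0 0
    rw [add_zero] at h₀
    linear_combination -h₀
  have even_part (t : X) : f t + f (-t) = (f 1 + f (-1)) * t ^ 2 := by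
    have ht := cauchy_difference_eq f g h t (-t)
    rw [add_neg_cancel] at ht
    linear_combination f_zero - ht
  have hneg := h (-x) (-y)
  rw [← neg_add] at hneg
  linear_combination 2 * (h x y - hneg + x * even_part y + y * even_part x)
end
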